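/- If g is a slowly varying function at +∞, then for every ε > 0 there exists B ≥ 1 such that sup_{B ≤ x ≤ n} g(x) x^ε divided by g(n) n^ε tends to 1 as n → ∞. -/

import Mathlib

open Filter

open MeasureTheory in
/-- **Uniform convergence theorem**, in additive form: a measurable `h` whose increments
`h (t + u) - h t` tend to `0` for every `u` has increments tending to `0` uniformly for
`u ∈ [0, 1]`. -/
theorem eventually_forall_abs_increment_le {h : ℝ → ℝ} (hm : Measurable h)
    (hh : ∀ u, Tendsto (fun t => h (t + u) - h t) atTop (nhds 0)) {η : ℝ} (hη : 0 < η) :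
    ∀ᶠ T in atTop, ∀ t ≥ T, ∀ w ∈ Set.Icc (0 : ℝ) 1, |h (t + w) - h t| ≤ η := by
  set ψ : ℝ → ℝ → ℝ := fun t u => min 1 |h (t + u) - h t| with hψ
  have ψ_meas (t : ℝ) : Measurable (ψ t) := by
    simp only [hψ]
    exact measurable_const.min
      (continuous_abs.measurable.comp ((hm.comp (measurable_const_add t)).sub_const _))
  have ψ_nonneg (t u : ℝ) : 0 ≤ ψ t u := le_min zero_le_one (abs_nonneg _)
  have ψ_norm_le (t u : ℝ) : ‖ψ t u‖ ≤ 1 := by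
    rw [Real.norm_of_nonneg (ψ_nonneg t u)]
    exact min_le_left _ _
  have ψ_int (t a b : ℝ) : IntervalIntegrable (ψ t) volume a b :=
    (intervalIntegrable_const (c := (1 : ℝ))).mono_fun (ψ_meas t).aestronglyMeasurable
      (Eventually.of_forall fun u => by simpa using ψ_norm_le t u)
  have ψ_lim : Tendsto (fun t => ∫ u in (0 : ℝ)..2, ψ t u) atTop (nhds 0) := by
    have key := intervalIntegral.tendsto_integral_filter_of_dominated_convergence
      (μ := volume) (a := 0) (b := 2) (l := atTop) (F := ψ) (f := fun _ => (0 : ℝ))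
      (fun _ => (1 : ℝ))
      (Eventually.of_forall fun t => (ψ_meas t).aestronglyMeasurable)
      (Eventually.of_forall fun t => Eventually.of_forall fun u _ => ψ_norm_le t u)
      intervalIntegrable_const
      (Eventually.of_forall fun u _ => by
        simpa [hψ] using (tendsto_const_nhds (x := (1 : ℝ))).min (hh u).abs)
    simpa using key
  set c := min η (1 / 2)
  have c_pos : 0 < c := lt_min hη (by norm_num)
  obtain ⟨T₀, hT₀⟩ := eventually_atTop.1 (ψ_lim.eventually_lt_const (half_pos c_pos))
  filter_upwards [eventually_ge_atTop T₀] with T hT t ht w ⟨hw0, hw1⟩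
  have pointwise (v : ℝ) : min 1 |h (t + w) - h t| ≤ ψ t v + ψ (t + w) (v - w) := by
    have e : t + w + (v - w) = t + v := by ring
    have tri := abs_sub_le (h (t + w)) (h (t + v)) (h t)
    rw [abs_sub_comm (h (t + w)) (h (t + v))] at tri
    simp only [hψ, e]
    grind
  have shifted_int : IntervalIntegrable (fun v => ψ (t + w) (v - w)) volume 1 2 := by
    simpa using (ψ_int (t + w) (1 - w) (2 - w)).comp_sub_right w
  have averaged : min 1 |h (t + w) - h t| ≤
      (∫ v in (1 : ℝ)..2, ψ t v) + ∫ v in (1 - w)..(2 - w), ψ (t + w) v := by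
    have := intervalIntegral.integral_mono_on (μ := volume) (a := 1) (b := 2) (by norm_num)
      intervalIntegrable_const ((ψ_int t 1 2).add shifted_int) (fun v _ => pointwise v)
    rw [intervalIntegral.integral_const, intervalIntegral.integral_add (ψ_int t 1 2) shifted_int,
      intervalIntegral.integral_comp_sub_right (ψ (t + w)) w] at this
    norm_num at this ⊢
    exact this
  have enlarge (s a b : ℝ) (ha : 0 ≤ a) (hab : a ≤ b) (hb : b ≤ 2) :
      ∫ v in a..b, ψ s v ≤ ∫ v in (0 : ℝ)..2, ψ s v :=
    intervalIntegral.integral_mono_interval ha hab hb (Eventually.of_forall (ψ_nonneg s))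
      (ψ_int s 0 2)
  have bound_left := enlarge t 1 2 (by norm_num) (by norm_num) le_rfl
  have bound_right := enlarge (t + w) (1 - w) (2 - w) (by linarith) (by linarith) (by linarith)
  have small_left := hT₀ t (by linarith)
  have small_right := hT₀ (t + w) (by linarith)
  have c_le : c ≤ η := min_le_left _ _
  have c_le_half : c ≤ 1 / 2 := min_le_right _ _
  have total : min 1 |h (t + w) - h t| < c := by linarith
  rcases min_lt_iff.1 total with h1 | h1 <;> linarith

/-- Bounded increments over steps of length at most one give linearly bounded increments. -/
theorem abs_increment_le_of_unit_steps {h : ℝ → ℝ} {T δ : ℝ}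
    (hT : ∀ t ≥ T, ∀ w ∈ Set.Icc (0 : ℝ) 1, |h (t + w) - h t| ≤ δ)
    {s d : ℝ} (hs : T ≤ s) (hd : 0 ≤ d) : |h (s + d) - h s| ≤ δ * (d + 1) := by
  have δ_nonneg : 0 ≤ δ := (abs_nonneg _).trans (hT T le_rfl 0 (by simp))
  obtain ⟨n, hn⟩ := exists_nat_ge d
  induction n generalizing d with
  | zero =>
    have := hT s hs d ⟨hd, by simp at hn; linarith⟩
    nlinarith
  | succ n ih =>
    rcases le_total d 1 with h1 | h1
    · have := hT s hs d ⟨hd, h1⟩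
      nlinarith
    · have init := ih (d := d - 1) (by linarith) (by push_cast at hn; linarith)
      have last := hT (s + (d - 1)) (by linarith) 1 (by simp)
      rw [show s + (d - 1) + 1 = s + d by ring] at last
      have := abs_sub_le (h (s + d)) (h (s + (d - 1))) (h s)
      linarith

/-- If the increments of a measurable `h` tend to `0`, then `t ↦ h t + ε t` is asymptotically
nondecreasing. -/
theorem exists_forall_add_mul_le {h : ℝ → ℝ} (hm : Measurable h)
    (hh : ∀ u, Tendsto (fun t => h (t + u) - h t) atTop (nhds 0)) {ε : ℝ} (hε : 0 < ε) :
    ∃ b : ℝ, 0 ≤ b ∧ ∀ η > 0, ∀ᶠ t in atTop, ∀ s ∈ Set.Icc b t,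
      h s + ε * s ≤ h t + ε * t + η := by
  obtain ⟨b, hb, b_nonneg⟩ := ((eventually_forall_abs_increment_le hm hh (half_pos hε)).and
    (eventually_ge_atTop 0)).exists
  refine ⟨b, b_nonneg, fun η hη => ?_⟩
  obtain ⟨T, hT⟩ := (eventually_forall_abs_increment_le hm hh hη).exists
  filter_upwards [eventually_ge_atTop (T + 1)] with t ht s ⟨hbs, hst⟩
  rcases le_total (t - s) 1 with h1 | h1
  · have := hT s (by linarith) (t - s) ⟨by linarith, h1⟩
    rw [add_sub_cancel, abs_le] at this
    nlinarith
  · have := abs_increment_le_of_unit_steps hb hbs (by linarith : 0 ≤ t - s)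
    rw [add_sub_cancel, abs_le] at this
    nlinarith

/-- If `g` is slowly varying at `+∞`, then for every `ε > 0` there exists `B ≥ 1` such that
`sup_{B ≤ x ≤ n} g(x) x^ε / (g(n) n^ε) → 1` as `n → ∞`. -/
theorem sup_slowly_varying_rpow_div_tendsto_one
    (g : ℝ → ℝ) (hg_pos : ∀ x ≥ (1 : ℝ), 0 < g x) (hg_meas : Measurable g)
    (hg_slow : ∀ l : ℝ, 0 < l →
      Tendsto (fun x : ℝ => g (l * x) / g x) atTop (nhds 1))
    (ε : ℝ) (hε : 0 < ε) :
    ∃ B : ℝ, 1 ≤ B ∧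
      Tendsto (fun n : ℕ =>
          (sSup ((fun x : ℝ => g x * x ^ ε) '' Set.Icc B (n : ℝ))) / (g n * (n : ℝ) ^ ε))
        atTop (nhds 1) := by
  set h : ℝ → ℝ := fun t => Real.log (g (Real.exp t)) with h_def
  have h_meas : Measurable h :=
    Real.measurable_log.comp (hg_meas.comp Real.measurable_exp)
  have h_incr (u : ℝ) : Tendsto (fun t => h (t + u) - h t) atTop (nhds 0) := by
    have lim := ((hg_slow (Real.exp u) (Real.exp_pos u)).comp Real.tendsto_exp_atTop).log
      one_ne_zero
    rw [Real.log_one] at lim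
    refine lim.congr' ?_
    filter_upwards [eventually_ge_atTop 0, eventually_ge_atTop (-u)] with t ht htu
    have pos := hg_pos (Real.exp t) (Real.one_le_exp ht)
    have pos_shift := hg_pos (Real.exp (t + u)) (Real.one_le_exp (by linarith))
    simp only [h_def, Function.comp_apply]
    rw [← Real.exp_add, add_comm u t, Real.log_div pos_shift.ne' pos.ne']
  have g_mul_rpow {x : ℝ} (hx : 1 ≤ x) :
      g x * x ^ ε = Real.exp (h (Real.log x) + ε * Real.log x) := by
    have x_pos : 0 < x := by linarith
    simp only [h_def]
    rw [Real.exp_add, Real.exp_log x_pos, Real.exp_log (hg_pos x hx),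
      Real.rpow_def_of_pos x_pos, mul_comm ε]
  obtain ⟨b, b_nonneg, hb⟩ := exists_forall_add_mul_le h_meas h_incr hε
  have one_le_B : 1 ≤ Real.exp b := Real.one_le_exp b_nonneg
  have log_cast : Tendsto (fun n : ℕ => Real.log n) atTop atTop :=
    Real.tendsto_log_atTop.comp tendsto_natCast_atTop_atTop
  refine ⟨Real.exp b, one_le_B, ?_⟩
  have bounds (η : ℝ) (hη : 0 < η) : ∀ᶠ n : ℕ in atTop,
      1 ≤ sSup ((fun x : ℝ => g x * x ^ ε) '' Set.Icc (Real.exp b) n) / (g n * (n : ℝ) ^ ε) ∧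
      sSup ((fun x : ℝ => g x * x ^ ε) '' Set.Icc (Real.exp b) n) / (g n * (n : ℝ) ^ ε)
        ≤ Real.exp η := by
    filter_upwards [log_cast.eventually (hb η hη),
      tendsto_natCast_atTop_atTop.eventually (eventually_ge_atTop (Real.exp b))] with n hn hBn
    have one_le_n : (1 : ℝ) ≤ n := one_le_B.trans hBn
    have denom_pos : 0 < g n * (n : ℝ) ^ ε := by
      rw [g_mul_rpow one_le_n]
      exact Real.exp_pos _
    have n_mem : g n * (n : ℝ) ^ ε ∈
        (fun x : ℝ => g x * x ^ ε) '' Set.Icc (Real.exp b) n := ⟨n, ⟨hBn, le_rfl⟩, rfl⟩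
    have upper : ∀ y ∈ (fun x : ℝ => g x * x ^ ε) '' Set.Icc (Real.exp b) n,
        y ≤ Real.exp η * (g n * (n : ℝ) ^ ε) := by
      rintro _ ⟨x, ⟨hBx, hxn⟩, rfl⟩
      have one_le_x : 1 ≤ x := one_le_B.trans hBx
      have x_pos : 0 < x := by linarith
      have := hn (Real.log x)
        ⟨(Real.le_log_iff_exp_le x_pos).2 hBx, Real.log_le_log x_pos hxn⟩
      simp only
      rw [g_mul_rpow one_le_x, g_mul_rpow one_le_n, ← Real.exp_add, Real.exp_le_exp]
      linarith
    exact ⟨(one_le_div denom_pos).2 (le_csSup ⟨_, upper⟩ n_mem),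
      (div_le_iff₀ denom_pos).2 (csSup_le ⟨_, n_mem⟩ upper)⟩
  refine tendsto_order.2 ⟨fun a ha => ?_, fun a ha => ?_⟩
  · filter_upwards [bounds 1 one_pos] with n hn
    exact ha.trans_le hn.1
  · have a_pos : 0 < a := by linarith
    filter_upwards [bounds (Real.log a / 2) (half_pos (Real.log_pos ha))] with n hn
    refine hn.2.trans_lt ((Real.lt_log_iff_exp_lt a_pos).1 ?_)
    linarith [Real.log_pos ha]
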